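/- arXiv:2509.23516 — 2 statements merged into one kernel-verified Lean document; each statement's English description precedes it below -/
import Mathlib

section
/- Let d̄, a, b, μ be real with a + μ > 0, let ρ > 0, and define k* = min{ (a + μ) − d̄, a b/(a + μ) − d̄ } and, for g ∈ ℝ, the 2 × 2 real matrix J(g ρ) with rows (d̄ + g ρ, −1) and (a b, −(a + μ)). Then every eigenvalue of J(g ρ) over ℂ has strictly negative real part if and only if g < k*/ρ. In particular the critical coupling gain is g* = k*/ρ. -/
/-- The Routh–Hurwitz criterion for real monic quadratics. -/
theorem forall_root_quadratic_re_neg_iff (p q : ℝ) :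
    (∀ z : ℂ, z ^ 2 + p * z + q = 0 → z.re < 0) ↔ 0 < p ∧ 0 < q := by
  constructor
  · intro h
    rcases le_total 0 (p ^ 2 - 4 * q) with hd | hd
    · have hs := Real.sq_sqrt hd
      have hs0 := Real.sqrt_nonneg (p ^ 2 - 4 * q)
      set s := √(p ^ 2 - 4 * q)
      have hz : (-p + s) / 2 < 0 := by
        simpa using h (((-p + s) / 2 : ℝ) : ℂ) (by
          norm_cast
          linear_combination hs / 4)
      exact ⟨by linarith, by nlinarith⟩
    · have hs := Real.sq_sqrt (show 0 ≤ 4 * q - p ^ 2 by linarith)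
      set s := √(4 * q - p ^ 2)
      have hz : -p / 2 < 0 := h ⟨-p / 2, s / 2⟩ (by
        apply Complex.ext
        · simp [pow_two]
          linear_combination -hs / 4
        · simp [pow_two]
          ring)
      have hp : 0 < p := by linarith
      exact ⟨hp, by nlinarith⟩
  · rintro ⟨hp, hq⟩ z hz
    have hre := congrArg Complex.re hz
    have him := congrArg Complex.im hz
    simp only [pow_two, Complex.add_re, Complex.mul_re, Complex.add_im, Complex.mul_im,
      Complex.ofReal_re, Complex.ofReal_im, Complex.zero_re, Complex.zero_im] at hre him
    by_contra! hx
    have hy : z.im = 0 := by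
      have : z.im * (2 * z.re + p) = 0 := by linarith
      exact (mul_eq_zero.mp this).resolve_right (by linarith)
    rw [hy] at hre
    nlinarith [mul_nonneg hp.le hx, mul_self_nonneg z.re]

/-- A real `2 × 2` matrix is Hurwitz stable iff its trace is negative and its determinant is
positive. -/
theorem forall_mem_spectrum_fin_two_re_neg_iff (A : Matrix (Fin 2) (Fin 2) ℝ) :
    (∀ z ∈ spectrum ℂ (A.map Complex.ofReal), z.re < 0) ↔ A.trace < 0 ∧ 0 < A.det := by
  have hspec (z : ℂ) : z ∈ spectrum ℂ (A.map Complex.ofReal) ↔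
      z ^ 2 + ((-A.trace : ℝ) : ℂ) * z + (A.det : ℂ) = 0 := by
    rw [Matrix.mem_spectrum_iff_isRoot_charpoly, Matrix.charpoly_fin_two]
    simp [Matrix.trace_fin_two, Matrix.det_fin_two]
    ring_nf
  simp only [hspec, forall_root_quadratic_re_neg_iff, neg_pos]


/-- With `a + μ > 0`, `ρ > 0`,
`k* = min{(a + μ) − d̄, a b/(a + μ) − d̄}`, and
`J(gρ) = [[d̄ + gρ, −1], [a b, −(a + μ)]]`, every eigenvalue of `J(gρ)` over `ℂ` has
strictly negative real part iff `g < k*/ρ`; the critical coupling gain is `g* = k*/ρ`. -/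
theorem nos_critical_coupling_gain (dbar a b μ ρ g : ℝ) (haμ : 0 < a + μ) (hρ : 0 < ρ) :
    (∀ z ∈ spectrum ℂ ((!![dbar + g * ρ, -1; a * b, -(a + μ)]).map Complex.ofReal),
        z.re < 0) ↔
      g < (min ((a + μ) - dbar) (a * b / (a + μ) - dbar)) / ρ := by
  rw [forall_mem_spectrum_fin_two_re_neg_iff, Matrix.trace_fin_two_of, Matrix.det_fin_two_of,
    lt_div_iff₀ hρ, lt_min_iff, lt_sub_iff_add_lt' (b := g * ρ),
    lt_sub_iff_add_lt' (b := g * ρ), lt_div_iff₀ haμ]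
  constructor <;> rintro ⟨h₁, h₂⟩ <;> constructor <;> linarith
end

section
/- Let n ≥ 1, let W be a real n × n matrix with zero diagonal, let d ∈ ℝⁿ, and let g, a, b, μ be real. Let 𝒥 be the real 2n × 2n block matrix with blocks 𝒥 = [[D + g W, −I_n], [a b I_n, −(a + μ) I_n]], where D = diag(d₁, …, d_n). If (i) d_i + 1 + |g| Σ_{j ≠ i} |W_{ij}| < 0 for every i, and (ii) |a b| < a + μ, then every eigenvalue of 𝒥 over ℂ has strictly negative real part. -/
/-- A real matrix whose Gershgorin discs all lie in the open left half-plane has only eigenvalues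
with negative real part. -/
theorem re_neg_of_mem_spectrum_of_diag_add_sum_neg {ι : Type*} [Fintype ι] [DecidableEq ι]
    {A : Matrix ι ι ℝ} (h : ∀ k, A k k + ∑ j ∈ Finset.univ.erase k, |A k j| < 0)
    {z : ℂ} (hz : z ∈ spectrum ℂ (A.map Complex.ofReal)) : z.re < 0 := by
  rw [← Matrix.spectrum_toLin', ← Module.End.hasEigenvalue_iff_mem_spectrum] at hz
  obtain ⟨k, hk⟩ := eigenvalue_mem_ball hz
  simp only [Metric.mem_closedBall, dist_eq_norm, Matrix.map_apply, Complex.norm_real,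
    Real.norm_eq_abs] at hk
  have hre := Complex.re_le_norm (z - A k k)
  rw [Complex.sub_re, Complex.ofReal_re] at hre
  linarith [h k]

/-- Every absolute row sum of `c • 1` is `|c|`. -/
theorem sum_abs_smul_one_row {ι : Type*} [Fintype ι] [DecidableEq ι] (c : ℝ) (i : ι) :
    ∑ j, |c * (1 : Matrix ι ι ℝ) i j| = |c| := by
  simp [Matrix.one_apply, apply_ite abs]


/-- Gershgorin certificate for the NOS block Jacobian: Let `W` be a real
`n × n` matrix with zero diagonal, `d ∈ ℝⁿ`, `g a b μ : ℝ`, and let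
`𝒥 = [[D + g W, −I], [a b I, −(a + μ) I]]` with `D = diag d`. If
(i) `d_i + 1 + |g| Σ_{j ≠ i} |W_{ij}| < 0` for every `i`, and (ii) `|a b| < a + μ`, then
every eigenvalue of `𝒥` over `ℂ` has strictly negative real part. -/
theorem nos_block_jacobian_gershgorin_stability (n : ℕ) (hn : 1 ≤ n)
    (W : Matrix (Fin n) (Fin n) ℝ) (hdiag : ∀ i, W i i = 0)
    (d : Fin n → ℝ) (g a b μ : ℝ)
    (h1 : ∀ i : Fin n, d i + 1 + |g| * ∑ j ∈ Finset.univ.erase i, |W i j| < 0)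
    (h2 : |a * b| < a + μ) :
    ∀ z ∈ spectrum ℂ
      ((Matrix.fromBlocks
          (Matrix.diagonal d + g • W)
          (-(1 : Matrix (Fin n) (Fin n) ℝ))
          ((a * b) • (1 : Matrix (Fin n) (Fin n) ℝ))
          (-((a + μ) • (1 : Matrix (Fin n) (Fin n) ℝ)))).map Complex.ofReal),
      z.re < 0 := by
  intro z hz
  refine re_neg_of_mem_spectrum_of_diag_add_sum_neg (fun k => ?_) hz
  rw [Finset.sum_erase_eq_sub (Finset.mem_univ k), Fintype.sum_sum_type]
  cases k with
  | inl i =>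
    have hone := sum_abs_smul_one_row 1 i
    have hoff : ∑ j ∈ Finset.univ.erase i, |Matrix.diagonal d i j + g * W i j| =
        |g| * ∑ j ∈ Finset.univ.erase i, |W i j| := by
      rw [Finset.mul_sum]
      refine Finset.sum_congr rfl fun j hj => ?_
      rw [Matrix.diagonal_apply_ne _ (Finset.ne_of_mem_erase hj).symm, zero_add, abs_mul]
    rw [Finset.sum_erase_eq_sub (Finset.mem_univ i)] at hoff
    simp only [one_mul, abs_one] at hone
    simp only [Matrix.fromBlocks_apply₁₁, Matrix.fromBlocks_apply₁₂, Matrix.add_apply,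
      Matrix.smul_apply, Matrix.neg_apply, smul_eq_mul, abs_neg, hone]
    simp only [hdiag, Matrix.diagonal_apply_eq, mul_zero, add_zero] at hoff ⊢
    linarith [h1 i]
  | inr i =>
    simp only [Matrix.fromBlocks_apply₂₁, Matrix.fromBlocks_apply₂₂, Matrix.smul_apply,
      Matrix.neg_apply, smul_eq_mul, abs_neg, sum_abs_smul_one_row, Matrix.one_apply_eq, mul_one]
    linarith
end
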